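/- Let r > 2 and define f₁(r) = [1 + 2·((r−2)/r)·√(r²−1) + 3·((r−2)/r) − (3/r)·((r−2)/r)·√(r²−1) + ((r−2)/r)²·(r − √(r²−1) + r²·π/4)] / [(1/4)·(r−2)²·(1/2)^(−log 4/log r)·(r−2)^(−log 4/log r)] and f₂(r) = [1 + √8·((r−2)/r) + (π/2)·((r−2)/r)²] / [(1/2)·((r−2)/r)²·(√(1/2))^(−log 4/log r)·((r−2)/r)^(−log 4/log r)]. If f₁(r) ≥ f₂(r), then C^r is not Minkowski measurable: the function ε ↦ λ²((C^r)_ε)/ε^(2 − D_r) does not converge to a limit in (0, ∞) as ε → 0⁺, since its limit superior is at least f₁(r) and its limit inferior is at most f₂(r), with strict inequalities against these bounds along the sequences ε = (1/2)·((r−2)/r)·r^(−(n−1)) and ε = √(1/2)·((r−2)/r)·r^(−n) respectively. -/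

import Mathlib

open MeasureTheory Metric Set Real Filter Topology ENNReal

/-- The similarity map `x ↦ x/r + (a, b)` of the plane. -/
noncomputable def cantorMap (r a b : ℝ) (x : EuclideanSpace ℝ (Fin 2)) :
    EuclideanSpace ℝ (Fin 2) :=
  r⁻¹ • x + (WithLp.equiv 2 (Fin 2 → ℝ)).symm ![a, b]

/-- `C` is the Cantor dust with parameter `r`: the (unique) nonempty compact set invariant
under the four similarities `S₁, S₂, S₃, S₄`. -/
def IsCantorDust (r : ℝ) (C : Set (EuclideanSpace ℝ (Fin 2))) : Prop :=
  IsCompact C ∧ C.Nonempty ∧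
    C = cantorMap r 0 0 '' C ∪ cantorMap r ((r - 1) / r) 0 '' C ∪
        cantorMap r ((r - 1) / r) ((r - 1) / r) '' C ∪ cantorMap r 0 ((r - 1) / r) '' C

/-- The lower-bound function `f₁` from Equation (12) of the paper. -/
noncomputable def f₁ (r : ℝ) : ℝ :=
  (1 + 2 * ((r - 2) / r) * Real.sqrt (r ^ 2 - 1) + 3 * ((r - 2) / r) -
      3 / r * ((r - 2) / r) * Real.sqrt (r ^ 2 - 1) +
      ((r - 2) / r) ^ 2 * (r - Real.sqrt (r ^ 2 - 1) + r ^ 2 * π / 4)) /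
    (1 / 4 * (r - 2) ^ 2 * (1 / 2 : ℝ) ^ (-(Real.log 4 / Real.log r)) *
      (r - 2) ^ (-(Real.log 4 / Real.log r)))

/-- The upper-bound function `f₂` from Equation (15) of the paper. -/
noncomputable def f₂ (r : ℝ) : ℝ :=
  (1 + Real.sqrt 8 * ((r - 2) / r) + π / 2 * ((r - 2) / r) ^ 2) /
    (1 / 2 * ((r - 2) / r) ^ 2 * Real.sqrt (1 / 2) ^ (-(Real.log 4 / Real.log r)) *
      ((r - 2) / r) ^ (-(Real.log 4 / Real.log r)))

/-- `K` is a nonempty compact set of reals invariant under `x ↦ x/r` and `x ↦ x/r + (r-1)/r`. -/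
def IsCantorLine (r : ℝ) (K : Set ℝ) : Prop :=
  IsCompact K ∧ K.Nonempty ∧
    ∀ x, x ∈ K ↔ ∃ k ∈ K, x = r⁻¹ * k ∨ x = r⁻¹ * k + (r - 1) / r

namespace IsCantorLine

variable {r : ℝ} {K : Set ℝ}

lemma inv_mul_mem (hK : IsCantorLine r K) {k : ℝ} (hk : k ∈ K) : r⁻¹ * k ∈ K :=
  (hK.2.2 _).2 ⟨k, hk, Or.inl rfl⟩

lemma inv_mul_add_mem (hK : IsCantorLine r K) {k : ℝ} (hk : k ∈ K) :
    r⁻¹ * k + (r - 1) / r ∈ K :=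
  (hK.2.2 _).2 ⟨k, hk, Or.inr rfl⟩

lemma isLeast_zero (hK : IsCantorLine r K) (hr : 2 < r) : IsLeast K 0 := by
  obtain ⟨m, hm, hmin⟩ := hK.1.exists_isLeast hK.2.1
  have hr0 : 0 < r⁻¹ := by positivity
  have hr1 : r⁻¹ < 1 := inv_lt_one_of_one_lt₀ (by linarith)
  have hle : m ≤ 0 := by
    have := hmin (hK.inv_mul_mem hm)
    nlinarith
  have hge : 0 ≤ m := by
    obtain ⟨k, hk, h | h⟩ := (hK.2.2 m).1 hm
    · have := hmin hk
      nlinarith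
    · have := hmin hk
      have : 0 < (r - 1) / r := div_pos (by linarith) (by linarith)
      nlinarith
  rw [le_antisymm hle hge] at hm hmin
  exact ⟨hm, hmin⟩

lemma isGreatest_one (hK : IsCantorLine r K) (hr : 2 < r) : IsGreatest K 1 := by
  obtain ⟨m, hm, hmax⟩ := hK.1.exists_isGreatest hK.2.1
  have hr0 : 0 < r⁻¹ := by positivity
  have hr1 : r⁻¹ < 1 := inv_lt_one_of_one_lt₀ (by linarith)
  have hr2 : (r - 1) / r = 1 - r⁻¹ := by field_simp
  have hge : 1 ≤ m := by
    have := hmax (hK.inv_mul_add_mem hm)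
    nlinarith
  have hle : m ≤ 1 := by
    obtain ⟨k, hk, h | h⟩ := (hK.2.2 m).1 hm
    · have := hmax hk
      nlinarith
    · have := hmax hk
      nlinarith
  rw [le_antisymm hle hge] at hm hmax
  exact ⟨hm, hmax⟩

lemma subset_Icc (hK : IsCantorLine r K) (hr : 2 < r) : K ⊆ Icc 0 1 :=
  fun _ hx => ⟨(hK.isLeast_zero hr).2 hx, (hK.isGreatest_one hr).2 hx⟩

lemma inv_mem (hK : IsCantorLine r K) (hr : 2 < r) : r⁻¹ ∈ K := by
  simpa using hK.inv_mul_mem (hK.isGreatest_one hr).1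

lemma one_sub_inv_mem (hK : IsCantorLine r K) (hr : 2 < r) : 1 - r⁻¹ ∈ K := by
  have h := hK.inv_mul_add_mem (hK.isLeast_zero hr).1
  rwa [show r⁻¹ * 0 + (r - 1) / r = 1 - r⁻¹ by field_simp; ring] at h

lemma infDist_half_pos (hK : IsCantorLine r K) (hr : 2 < r) : 0 < infDist (1 / 2) K := by
  rw [← hK.1.isClosed.notMem_iff_infDist_pos hK.2.1]
  intro h
  have hr0 : 0 < r := by linarith
  obtain ⟨k, hk, h | h⟩ := (hK.2.2 _).1 h
  · have := (hK.subset_Icc hr hk).2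
    field_simp at h
    linarith
  · have := (hK.subset_Icc hr hk).1
    field_simp at h
    linarith

lemma infDist_of_nonpos (hK : IsCantorLine r K) (hr : 2 < r) {x : ℝ} (hx : x ≤ 0) :
    infDist x K = -x := by
  apply le_antisymm
  · refine (infDist_le_dist_of_mem (hK.isLeast_zero hr).1).trans_eq ?_
    rw [dist_zero_right, Real.norm_eq_abs, abs_of_nonpos hx]
  · rw [le_infDist hK.2.1]
    intro y hy
    rw [dist_comm, Real.dist_eq]
    have := (hK.subset_Icc hr hy).1
    linarith [le_abs_self (y - x)]

lemma infDist_of_one_le (hK : IsCantorLine r K) (hr : 2 < r) {x : ℝ} (hx : 1 ≤ x) :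
    infDist x K = x - 1 := by
  apply le_antisymm
  · refine (infDist_le_dist_of_mem (hK.isGreatest_one hr).1).trans_eq ?_
    rw [Real.dist_eq, abs_of_nonneg (by linarith)]
  · rw [le_infDist hK.2.1]
    intro y hy
    rw [Real.dist_eq]
    have := (hK.subset_Icc hr hy).2
    linarith [le_abs_self (x - y)]

lemma infDist_inv_mul_le (hK : IsCantorLine r K) (hr : 2 < r) (x : ℝ) :
    infDist (r⁻¹ * x) K ≤ r⁻¹ * infDist x K := by
  obtain ⟨k, hk, h⟩ := hK.1.exists_infDist_eq_dist hK.2.1 x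
  refine (infDist_le_dist_of_mem (hK.inv_mul_mem hk)).trans_eq ?_
  rw [h, Real.dist_eq, Real.dist_eq, ← mul_sub, abs_mul, abs_of_pos (by positivity)]

lemma infDist_inv_mul_add_le (hK : IsCantorLine r K) (hr : 2 < r) (x : ℝ) :
    infDist (r⁻¹ * x + (r - 1) / r) K ≤ r⁻¹ * infDist x K := by
  obtain ⟨k, hk, h⟩ := hK.1.exists_infDist_eq_dist hK.2.1 x
  refine (infDist_le_dist_of_mem (hK.inv_mul_add_mem hk)).trans_eq ?_
  rw [h, Real.dist_eq, Real.dist_eq, add_sub_add_right_eq_sub, ← mul_sub, abs_mul,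
    abs_of_pos (by positivity)]

lemma infDist_le_abs_sub_inv (hK : IsCantorLine r K) (hr : 2 < r) (x : ℝ) :
    infDist x K ≤ |x - r⁻¹| :=
  infDist_le_dist_of_mem (hK.inv_mem hr)

lemma infDist_le_abs_sub_one_sub_inv (hK : IsCantorLine r K) (hr : 2 < r) (x : ℝ) :
    infDist x K ≤ |x - (1 - r⁻¹)| :=
  infDist_le_dist_of_mem (hK.one_sub_inv_mem hr)

lemma infDist_le (hK : IsCantorLine r K) (hr : 2 < r) {x : ℝ} (hx : x ∈ Icc (0 : ℝ) 1) :
    infDist x K ≤ (1 - 2 * r⁻¹) / 2 := by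
  obtain ⟨m, hm, hmax⟩ := isCompact_Icc.exists_isMaxOn (⟨0, by simp⟩ : (Icc (0 : ℝ) 1).Nonempty)
    (continuous_infDist_pt K).continuousOn
  refine (hmax hx).trans ?_
  have hr0 : 0 < r⁻¹ := by positivity
  have hr1 : r⁻¹ < 1 / 2 := by rw [inv_lt_comm₀] <;> norm_num <;> linarith
  have hrr : r * r⁻¹ = 1 := mul_inv_cancel₀ (by linarith)
  have hd : (r - 1) / r = 1 - r⁻¹ := by field_simp
  have key : ∀ y ∈ Icc (0 : ℝ) 1, infDist m K ≤ r⁻¹ * infDist y K →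
      infDist m K ≤ (1 - 2 * r⁻¹) / 2 := by
    intro y hy h
    have h2 : infDist y K ≤ infDist m K := hmax hy
    nlinarith [infDist_nonneg (x := m) (s := K)]
  rcases le_total m r⁻¹ with h | h
  · refine key (r * m) ⟨by nlinarith [hm.1], by nlinarith⟩ ?_
    have := hK.infDist_inv_mul_le hr (r * m)
    rwa [← mul_assoc, mul_comm r⁻¹ r, hrr, one_mul] at this
  rcases le_total m (1 / 2) with h' | h'
  · refine (hK.infDist_le_abs_sub_inv hr m).trans ?_
    rw [abs_le]; constructor <;> linarith
  rcases le_total m (1 - r⁻¹) with h'' | h''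
  · refine (hK.infDist_le_abs_sub_one_sub_inv hr m).trans ?_
    rw [abs_le]; constructor <;> linarith
  · refine key (r * m - (r - 1)) ⟨by nlinarith, by nlinarith [hm.2]⟩ ?_
    have := hK.infDist_inv_mul_add_le hr (r * m - (r - 1))
    rwa [show r⁻¹ * (r * m - (r - 1)) + (r - 1) / r = m by field_simp; ring] at this

lemma infDist_le_of_le_inv (hK : IsCantorLine r K) (hr : 2 < r) {x : ℝ}
    (hx : x ∈ Icc (0 : ℝ) r⁻¹) : infDist x K ≤ r⁻¹ * ((1 - 2 * r⁻¹) / 2) := by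
  have hr0 : 0 < r⁻¹ := by positivity
  have hrr : r * r⁻¹ = 1 := mul_inv_cancel₀ (by linarith)
  have h := hK.infDist_inv_mul_le hr (r * x)
  rw [← mul_assoc, mul_comm r⁻¹ r, hrr, one_mul] at h
  refine h.trans (mul_le_mul_of_nonneg_left (hK.infDist_le hr ⟨?_, ?_⟩) hr0.le)
  · nlinarith [hx.1]
  · nlinarith [hx.2]

lemma infDist_le_of_one_sub_inv_le (hK : IsCantorLine r K) (hr : 2 < r) {x : ℝ}
    (hx : x ∈ Icc (1 - r⁻¹) 1) : infDist x K ≤ r⁻¹ * ((1 - 2 * r⁻¹) / 2) := by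
  have hr0 : 0 < r⁻¹ := by positivity
  have hrr : r * r⁻¹ = 1 := mul_inv_cancel₀ (by linarith)
  have h := hK.infDist_inv_mul_add_le hr (r * x - (r - 1))
  rw [show r⁻¹ * (r * x - (r - 1)) + (r - 1) / r = x by field_simp; ring] at h
  refine h.trans (mul_le_mul_of_nonneg_left (hK.infDist_le hr ⟨?_, ?_⟩) hr0.le)
  · nlinarith [hx.1]
  · nlinarith [hx.2]

end IsCantorLine

namespace IsCantorLine

variable {r : ℝ} {K : Set ℝ}

lemma continuous_sqrt_sub_infDist_sq (K : Set ℝ) (ε : ℝ) :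
    Continuous fun t => √(ε ^ 2 - infDist t K ^ 2) :=
  (continuous_const.sub ((continuous_infDist_pt K).pow 2)).sqrt

lemma integral_sqrt_lt (hK : IsCantorLine r K) (hr : 2 < r) {ε : ℝ} (hε : 0 < ε) :
    ∫ t in (0 : ℝ)..1, √(ε ^ 2 - infDist t K ^ 2) < ε := by
  have h : ∫ t in (0 : ℝ)..1, √(ε ^ 2 - infDist t K ^ 2) < ∫ _ in (0 : ℝ)..1, ε := by
    apply intervalIntegral.integral_lt_integral_of_continuousOn_of_le_of_exists_lt one_pos
      (continuous_sqrt_sub_infDist_sq K ε).continuousOn continuousOn_const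
    · intro t _
      rw [Real.sqrt_le_left hε.le]
      nlinarith [sq_nonneg (infDist t K)]
    · refine ⟨1 / 2, by norm_num, ?_⟩
      rw [Real.sqrt_lt' hε]
      nlinarith [hK.infDist_half_pos hr]
  simpa using h

lemma integral_infDist_sq_le (hK : IsCantorLine r K) (hr : 2 < r) :
    ∫ t in (0 : ℝ)..1, infDist t K ^ 2 ≤
      (1 - 2 * r⁻¹) ^ 3 / 12 + (1 - 2 * r⁻¹) ^ 2 * r⁻¹ ^ 3 / 2 := by
  have hc : Continuous fun t => infDist t K ^ 2 := (continuous_infDist_pt K).pow 2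
  have hi : ∀ a b : ℝ, IntervalIntegrable (fun t => infDist t K ^ 2) volume a b :=
    fun a b => hc.intervalIntegrable a b
  have hr0 : 0 < r⁻¹ := by positivity
  have hr1 : r⁻¹ < 1 / 2 := by rw [inv_lt_comm₀] <;> norm_num <;> linarith
  set u := r⁻¹
  have h1 : ∫ t in (0 : ℝ)..u, infDist t K ^ 2 ≤ u * (u * ((1 - 2 * u) / 2)) ^ 2 := by
    have := intervalIntegral.integral_mono_on hr0.le (hi 0 u)
      (_root_.intervalIntegrable_const (c := (u * ((1 - 2 * u) / 2)) ^ 2))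
      fun x hx => pow_le_pow_left₀ infDist_nonneg (hK.infDist_le_of_le_inv hr hx) 2
    simpa using this
  have h2 : ∫ t in u..(1 / 2), infDist t K ^ 2 ≤ (1 - 2 * u) ^ 3 / 24 := by
    have := intervalIntegral.integral_mono_on hr1.le (hi u (1 / 2))
      (Continuous.intervalIntegrable (by fun_prop : Continuous fun t : ℝ => (t - u) ^ 2) _ _)
      fun x hx => (pow_le_pow_left₀ infDist_nonneg (hK.infDist_le_abs_sub_inv hr x) 2).trans_eq
        (sq_abs _)
    refine this.trans_eq ?_
    rw [intervalIntegral.integral_comp_sub_right (fun x => x ^ 2), integral_pow]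
    ring
  have h3 : ∫ t in (1 / 2)..(1 - u), infDist t K ^ 2 ≤ (1 - 2 * u) ^ 3 / 24 := by
    have := intervalIntegral.integral_mono_on (by linarith) (hi (1 / 2) (1 - u))
      (Continuous.intervalIntegrable (by fun_prop : Continuous fun t : ℝ => (t - (1 - u)) ^ 2) _ _)
      fun x hx => (pow_le_pow_left₀ infDist_nonneg
        (hK.infDist_le_abs_sub_one_sub_inv hr x) 2).trans_eq (sq_abs _)
    refine this.trans_eq ?_
    rw [intervalIntegral.integral_comp_sub_right (fun x => x ^ 2), integral_pow]
    ring
  have h4 : ∫ t in (1 - u)..1, infDist t K ^ 2 ≤ u * (u * ((1 - 2 * u) / 2)) ^ 2 := by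
    have := intervalIntegral.integral_mono_on (by linarith) (hi (1 - u) 1)
      (_root_.intervalIntegrable_const (c := (u * ((1 - 2 * u) / 2)) ^ 2))
      fun x hx => pow_le_pow_left₀ infDist_nonneg (hK.infDist_le_of_one_sub_inv_le hr hx) 2
    simpa using this
  rw [← intervalIntegral.integral_add_adjacent_intervals (hi 0 (1 / 2)) (hi (1 / 2) 1),
    ← intervalIntegral.integral_add_adjacent_intervals (hi 0 u) (hi u (1 / 2)),
    ← intervalIntegral.integral_add_adjacent_intervals (hi (1 / 2) (1 - u)) (hi (1 - u) 1)]
  calc _ ≤ _ := add_le_add (add_le_add h1 h2) (add_le_add h3 h4)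
    _ = _ := by ring

lemma sub_sqrt_le {r g d : ℝ} (hr : 1 ≤ r) (hg : 0 < g) (hd0 : 0 ≤ d) (hd : d ≤ g / 2) :
    r * g / 2 - √((r * g / 2) ^ 2 - d ^ 2) ≤ 2 / g * (r - √(r ^ 2 - 1)) * d ^ 2 := by
  have hs : √(r ^ 2 - 1) ^ 2 = r ^ 2 - 1 := Real.sq_sqrt (by nlinarith)
  have hs0 := Real.sqrt_nonneg (r ^ 2 - 1)
  set s := √(r ^ 2 - 1)
  have hw : (g / 2 * s) ≤ √((r * g / 2) ^ 2 - d ^ 2) := by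
    apply Real.le_sqrt_of_sq_le
    rw [mul_pow, hs]
    nlinarith
  have hw2 : √((r * g / 2) ^ 2 - d ^ 2) ^ 2 = (r * g / 2) ^ 2 - d ^ 2 := by
    apply Real.sq_sqrt
    have : g ≤ r * g := by nlinarith
    nlinarith
  set w := √((r * g / 2) ^ 2 - d ^ 2)
  have hrs : 2 / g * (r - s) = (g / 2 * (r + s))⁻¹ := by
    have : 0 < r + s := by linarith
    field_simp
    nlinarith
  have hpos : 0 < g / 2 * (r + s) := by positivity
  rw [hrs, inv_mul_eq_div, le_div_iff₀ hpos]
  have hle : 0 ≤ r * g / 2 - w := by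
    have : w ≤ r * g / 2 := by
      apply abs_le_of_sq_le_sq' _ (by positivity) |>.2
      nlinarith
    linarith
  nlinarith [mul_le_mul_of_nonneg_left hw hle]

lemma lt_integral_sqrt (hK : IsCantorLine r K) (hr : 2 < r) :
    (r - 2) / 2 - (r - √(r ^ 2 - 1)) * ((r - 2) / r) * (r - 1) / (4 * r) <
      ∫ t in (0 : ℝ)..1, √(((r - 2) / 2) ^ 2 - infDist t K ^ 2) := by
  have hr0 : 0 < r⁻¹ := by positivity
  have hr1 : r⁻¹ < 1 / 2 := by rw [inv_lt_comm₀] <;> norm_num <;> linarith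
  have hrr : r * r⁻¹ = 1 := mul_inv_cancel₀ (by linarith)
  have hg : (r - 2) / r = 1 - 2 * r⁻¹ := by field_simp
  have hs : √(r ^ 2 - 1) < r := by
    rw [Real.sqrt_lt' (by linarith)]
    linarith
  have hε : (r - 2) / 2 = r * (1 - 2 * r⁻¹) / 2 := by
    field_simp
  have hJ := hK.integral_infDist_sq_le hr
  have hle : ∫ t in (0 : ℝ)..1, ((r - 2) / 2 - √(((r - 2) / 2) ^ 2 - infDist t K ^ 2)) ≤
      ∫ t in (0 : ℝ)..1, 2 / (1 - 2 * r⁻¹) * (r - √(r ^ 2 - 1)) * infDist t K ^ 2 := by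
    apply intervalIntegral.integral_mono_on zero_le_one
    · exact (continuous_const.sub (continuous_sqrt_sub_infDist_sq K _)).intervalIntegrable _ _
    · exact (continuous_const.mul ((continuous_infDist_pt K).pow 2)).intervalIntegrable _ _
    · intro t ht
      rw [hε]
      exact sub_sqrt_le (by linarith) (by linarith) infDist_nonneg (hK.infDist_le hr ht)
  rw [intervalIntegral.integral_sub _root_.intervalIntegrable_const
    ((continuous_sqrt_sub_infDist_sq K _).intervalIntegrable _ _),
    intervalIntegral.integral_const_mul] at hle
  simp only [intervalIntegral.integral_const, sub_zero, one_smul] at hle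
  set u := r⁻¹
  have hq : (r - 1) / (4 * r) = (1 - u) / 4 := by
    simp only [u]; field_simp
  rw [mul_div_assoc, hq, hg]
  have hJlt : 2 / (1 - 2 * u) * (∫ t in (0 : ℝ)..1, infDist t K ^ 2) <
      (1 - 2 * u) * ((1 - u) / 4) := by
    have hgp : 0 < 1 - 2 * u := by linarith
    rw [div_mul_eq_mul_div, div_lt_iff₀ hgp]
    have hu : 12 * u ^ 3 < 1 + u := by nlinarith [mul_pos hr0 hgp, mul_pos hr0 (mul_pos hr0 hgp)]
    have hg2 : 0 < (1 - 2 * u) ^ 2 := by positivity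
    nlinarith [mul_lt_mul_of_pos_left hu hg2]
  nlinarith [mul_lt_mul_of_pos_left hJlt (sub_pos.2 hs)]

end IsCantorLine

lemma map_volume_eq_of_eq_neg_of_eq_sub {f : ℝ → ℝ} (hf : Measurable f) {a : ℝ} (ha : 0 ≤ a)
    (h0 : ∀ x < 0, f x = -x) (h1 : ∀ x > a, f x = x - a) :
    (volume : Measure ℝ).map f = volume.restrict (Ioi 0) + volume.restrict (Ioi 0) +
      (volume.restrict (Icc 0 a)).map f := by
  ext s hs
  have hneg : f ⁻¹' s ∩ Iio 0 = (fun x => -x) ⁻¹' (s ∩ Ioi 0) := by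
    ext x
    simp only [mem_inter_iff, mem_preimage, mem_Iio, mem_Ioi, Left.neg_pos_iff]
    refine and_congr_left fun hx => ?_
    rw [h0 x hx]
  have hpos : f ⁻¹' s ∩ Ioi a = (fun x => x - a) ⁻¹' (s ∩ Ioi 0) := by
    ext x
    simp only [mem_inter_iff, mem_preimage, mem_Ioi, sub_pos]
    refine and_congr_left fun hx => ?_
    rw [h1 x hx]
  have hunion : f ⁻¹' s = (f ⁻¹' s ∩ Iio 0 ∪ f ⁻¹' s ∩ Ioi a) ∪ f ⁻¹' s ∩ Icc 0 a := by
    ext x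
    simp only [mem_union, mem_inter_iff, mem_Iio, mem_Ioi, mem_Icc]
    have := lt_or_ge x 0
    have := lt_or_ge a x
    tauto
  have hm := hf hs
  rw [Measure.map_apply hf hs, hunion, measure_union _ (hm.inter measurableSet_Icc),
    measure_union _ (hm.inter measurableSet_Ioi), hneg, hpos, Measure.measure_preimage_neg]
  simp_rw [sub_eq_add_neg]
  rw [measure_preimage_add_right]
  · simp only [Measure.add_apply]
    rw [Measure.restrict_apply hs, Measure.map_apply hf hs, Measure.restrict_apply hm]
  · refine Set.disjoint_left.2 fun x hx hx' => ?_
    have := hx.2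
    have := hx'.2
    simp only [mem_Iio, mem_Ioi] at *
    linarith
  · refine Set.disjoint_left.2 fun x hx hx' => ?_
    have h2 := hx'.2
    rcases hx with hx | hx
    · exact not_lt.2 h2.1 hx.2
    · exact not_lt.2 h2.2 hx.2

lemma map_abs_volume : (volume : Measure ℝ).map (fun x => |x|) =
    volume.restrict (Ioi 0) + volume.restrict (Ioi 0) := by
  rw [map_volume_eq_of_eq_neg_of_eq_sub (f := fun x : ℝ => |x|) (a := 0) (by fun_prop) le_rfl
    (fun x hx => abs_of_neg hx) (fun x hx => by rw [sub_zero, abs_of_pos hx])]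
  simp

lemma volume_setOf_sq_add_sq_le {ε : ℝ} (hε : 0 ≤ ε) :
    volume {p : ℝ × ℝ | p.1 ^ 2 + p.2 ^ 2 ≤ ε ^ 2} = ENNReal.ofReal (π * ε ^ 2) := by
  have hm : MeasurableSet {p : ℝ × ℝ | p.1 ^ 2 + p.2 ^ 2 ≤ ε ^ 2} :=
    measurableSet_le (by fun_prop) (by fun_prop)
  rw [← Complex.volume_preserving_equiv_real_prod.measure_preimage hm.nullMeasurableSet]
  have : Complex.measurableEquivRealProd ⁻¹' {p : ℝ × ℝ | p.1 ^ 2 + p.2 ^ 2 ≤ ε ^ 2} =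
      closedBall (0 : ℂ) ε := by
    ext z
    simp only [mem_preimage, Complex.measurableEquivRealProd_apply, mem_ofPred_eq,
      mem_closedBall, dist_zero_right]
    rw [← sq_le_sq₀ (norm_nonneg z) hε, Complex.sq_norm, Complex.normSq_apply]
    ring_nf
  rw [this, Complex.volume_closedBall, mul_comm π, ENNReal.ofReal_mul (by positivity),
    ENNReal.ofReal_pow hε, ← NNReal.coe_real_pi, ENNReal.ofReal_coe_nnreal]

lemma volume_restrict_Ioi_setOf_sq_le (c : ℝ) :
    (volume.restrict (Ioi 0)) {x : ℝ | x ^ 2 ≤ c} = ENNReal.ofReal √c := by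
  rw [Measure.restrict_apply (measurableSet_le (by fun_prop) (by fun_prop))]
  have : {x : ℝ | x ^ 2 ≤ c} ∩ Ioi 0 = Ioc 0 √c := by
    ext x
    simp only [mem_inter_iff, mem_ofPred_eq, mem_Ioi, mem_Ioc]
    rw [and_comm]
    exact and_congr_right fun hx => (Real.le_sqrt' hx).symm
  rw [this, Real.volume_Ioc, sub_zero]

namespace IsCantorLine

variable {r : ℝ} {K : Set ℝ}

lemma map_infDist_volume (hK : IsCantorLine r K) (hr : 2 < r) :
    (volume : Measure ℝ).map (infDist · K) =
      volume.restrict (Ioi 0) + volume.restrict (Ioi 0) +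
        (volume.restrict (Icc 0 1)).map (infDist · K) :=
  map_volume_eq_of_eq_neg_of_eq_sub (by fun_prop) zero_le_one
    (fun _ hx => hK.infDist_of_nonpos hr hx.le) (fun _ hx => hK.infDist_of_one_le hr hx.le)

lemma lintegral_map_infDist (K : Set ℝ) (ε : ℝ) :
    ∫⁻ y, ENNReal.ofReal √(ε ^ 2 - y ^ 2) ∂((volume.restrict (Icc 0 1)).map (infDist · K)) =
      ENNReal.ofReal (∫ t in (0 : ℝ)..1, √(ε ^ 2 - infDist t K ^ 2)) := by
  rw [lintegral_map (by fun_prop) (by fun_prop),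
    intervalIntegral.integral_of_le zero_le_one, ← integral_Icc_eq_integral_Ioc,
    ofReal_integral_eq_lintegral_ofReal]
  · exact (continuous_sqrt_sub_infDist_sq K ε).continuousOn.integrableOn_Icc
  · exact Filter.Eventually.of_forall fun _ => Real.sqrt_nonneg _

lemma volume_setOf_infDist_sq_add_le {K₁ K₂ : Set ℝ} (h₁ : IsCantorLine r K₁)
    (h₂ : IsCantorLine r K₂) (hr : 2 < r) {ε : ℝ} (hε : 0 ≤ ε)
    (hε' : (1 - 2 * r⁻¹) ^ 2 / 2 ≤ ε ^ 2) :
    volume {p : ℝ × ℝ | infDist p.1 K₁ ^ 2 + infDist p.2 K₂ ^ 2 ≤ ε ^ 2} =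
      ENNReal.ofReal (π * ε ^ 2 + 2 * (∫ t in (0 : ℝ)..1, √(ε ^ 2 - infDist t K₁ ^ 2)) +
        2 * (∫ t in (0 : ℝ)..1, √(ε ^ 2 - infDist t K₂ ^ 2)) + 1) := by
  set D : Set (ℝ × ℝ) := {p | p.1 ^ 2 + p.2 ^ 2 ≤ ε ^ 2} with hD
  have hm : MeasurableSet D := measurableSet_le (by fun_prop) (by fun_prop)
  set N : Measure ℝ := volume.restrict (Ioi 0) with hN
  set μ₁ : Measure ℝ := (volume.restrict (Icc 0 1)).map (infDist · K₁) with hμ₁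
  set μ₂ : Measure ℝ := (volume.restrict (Icc 0 1)).map (infDist · K₂) with hμ₂
  have hd (K : Set ℝ) : Measurable (infDist · K) := by fun_prop
  have hvol : volume {p : ℝ × ℝ | infDist p.1 K₁ ^ 2 + infDist p.2 K₂ ^ 2 ≤ ε ^ 2} =
      ((N + N + μ₁).prod (N + N + μ₂)) D := by
    rw [← h₁.map_infDist_volume hr, ← h₂.map_infDist_volume hr,
      Measure.map_prod_map _ _ (hd _) (hd _),
      Measure.map_apply ((hd _).prodMap (hd _)) hm]
    rfl
  have hNN : (N.prod N) D + (N.prod N) D + ((N.prod N) D + (N.prod N) D) =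
      ENNReal.ofReal (π * ε ^ 2) := by
    have habs : Measurable fun x : ℝ => |x| := by fun_prop
    rw [← volume_setOf_sq_add_sq_le hε]
    trans ((N + N).prod (N + N)) D
    · simp only [Measure.add_prod, Measure.prod_add, Measure.add_apply]
    · rw [hN, ← map_abs_volume, Measure.map_prod_map _ _ habs habs,
        Measure.map_apply (habs.prodMap habs) hm]
      congr 1
      ext p
      simp [hD]
  have hN₂ : (N.prod μ₂) D =
      ENNReal.ofReal (∫ t in (0 : ℝ)..1, √(ε ^ 2 - infDist t K₂ ^ 2)) := by
    rw [Measure.prod_apply_symm hm, ← lintegral_map_infDist]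
    refine lintegral_congr fun y => ?_
    rw [← volume_restrict_Ioi_setOf_sq_le]
    congr 1
    ext x
    simp [hD, le_sub_iff_add_le]
  have h₁N : (μ₁.prod N) D =
      ENNReal.ofReal (∫ t in (0 : ℝ)..1, √(ε ^ 2 - infDist t K₁ ^ 2)) := by
    rw [Measure.prod_apply hm, ← lintegral_map_infDist]
    refine lintegral_congr fun y => ?_
    rw [← volume_restrict_Ioi_setOf_sq_le]
    congr 1
    ext x
    simp [hD, le_sub_iff_add_le']
  have h₁₂ : (μ₁.prod μ₂) D = ENNReal.ofReal 1 := by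
    rw [Measure.map_prod_map _ _ (hd _) (hd _), Measure.map_apply ((hd _).prodMap (hd _)) hm,
      Measure.prod_restrict, Measure.restrict_apply ((hd _).prodMap (hd _) hm),
      inter_eq_self_of_subset_right, Measure.prod_prod, Real.volume_Icc]
    · simp
    · rintro ⟨x, y⟩ ⟨hx, hy⟩
      have hx' := pow_le_pow_left₀ infDist_nonneg (h₁.infDist_le hr hx) 2
      have hy' := pow_le_pow_left₀ infDist_nonneg (h₂.infDist_le hr hy) 2
      simp only [hD, mem_preimage, Prod.map_apply, mem_ofPred_eq]
      linarith
  have hI (K : Set ℝ) : 0 ≤ ∫ t in (0 : ℝ)..1, √(ε ^ 2 - infDist t K ^ 2) :=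
    intervalIntegral.integral_nonneg zero_le_one fun _ _ => Real.sqrt_nonneg _
  have := hI K₁
  have := hI K₂
  have hπ : 0 ≤ π * ε ^ 2 := by positivity
  rw [hvol, ENNReal.ofReal_add (by positivity) zero_le_one,
    ENNReal.ofReal_add (by positivity) (by positivity),
    ENNReal.ofReal_add (by positivity) (by positivity), two_mul, two_mul,
    ENNReal.ofReal_add (hI _) (hI _), ENNReal.ofReal_add (hI _) (hI _), ← hNN, ← hN₂, ← h₁N,
    ← h₁₂]
  simp only [Measure.add_prod, Measure.prod_add, Measure.add_apply]
  ring

end IsCantorLine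

section CantorMap

variable {r : ℝ} {a b : ℝ}

lemma cantorMap_apply_zero (r a b : ℝ) (x : EuclideanSpace ℝ (Fin 2)) :
    cantorMap r a b x 0 = r⁻¹ * x 0 + a := by
  simp [cantorMap]

lemma cantorMap_apply_one (r a b : ℝ) (x : EuclideanSpace ℝ (Fin 2)) :
    cantorMap r a b x 1 = r⁻¹ * x 1 + b := by
  simp [cantorMap]

lemma dist_cantorMap (hr : 0 < r) (x y : EuclideanSpace ℝ (Fin 2)) :
    dist (cantorMap r a b x) (cantorMap r a b y) = r⁻¹ * dist x y := by
  rw [cantorMap, cantorMap, dist_add_right, dist_smul₀, Real.norm_eq_abs,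
    abs_of_pos (inv_pos.2 hr)]

lemma cantorMap_surjective (hr : 0 < r) : Function.Surjective (cantorMap r a b) := by
  intro y
  refine ⟨r • (y - (WithLp.equiv 2 (Fin 2 → ℝ)).symm ![a, b]), ?_⟩
  rw [cantorMap, smul_smul, inv_mul_cancel₀ hr.ne', one_smul, sub_add_cancel]

lemma continuous_cantorMap : Continuous (cantorMap r a b) := by
  unfold cantorMap
  fun_prop

open Pointwise in
lemma volume_image_cantorMap (A : Set (EuclideanSpace ℝ (Fin 2))) :
    volume (cantorMap r a b '' A) = ENNReal.ofReal (r⁻¹ ^ 2) * volume A := by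
  have : cantorMap r a b '' A =
      (fun x => x + (WithLp.equiv 2 (Fin 2 → ℝ)).symm ![a, b]) '' (r⁻¹ • A) := by
    rw [← image_smul, image_image]
    rfl
  rw [this, image_add_right, measure_preimage_add_right, Measure.addHaar_smul]
  simp

lemma mem_cthickening_iff_of_isCompact {A : Set (EuclideanSpace ℝ (Fin 2))} (hA : IsCompact A)
    {ε : ℝ} (hε : 0 ≤ ε) {x : EuclideanSpace ℝ (Fin 2)} :
    x ∈ cthickening ε A ↔ ∃ c ∈ A, dist x c ≤ ε := by
  simp [hA.cthickening_eq_biUnion_closedBall hε]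

lemma cthickening_image_cantorMap (hr : 0 < r) {A : Set (EuclideanSpace ℝ (Fin 2))}
    (hA : IsCompact A) {ε : ℝ} (hε : 0 ≤ ε) :
    cthickening ε (cantorMap r a b '' A) = cantorMap r a b '' cthickening (r * ε) A := by
  have key (x c : EuclideanSpace ℝ (Fin 2)) :
      dist (cantorMap r a b x) (cantorMap r a b c) ≤ ε ↔ dist x c ≤ r * ε := by
    rw [dist_cantorMap hr, inv_mul_le_iff₀ hr]
  ext y
  rw [mem_cthickening_iff_of_isCompact (hA.image continuous_cantorMap) hε]
  simp only [exists_mem_image]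
  constructor
  · rintro ⟨c, hc, h⟩
    obtain ⟨x, rfl⟩ := cantorMap_surjective (a := a) (b := b) hr y
    exact mem_image_of_mem _ ((mem_cthickening_iff_of_isCompact hA (by positivity)).2
      ⟨c, hc, (key _ _).1 h⟩)
  · rintro ⟨x, hx, rfl⟩
    obtain ⟨c, hc, h⟩ := (mem_cthickening_iff_of_isCompact hA (by positivity)).1 hx
    exact ⟨c, hc, (key _ _).2 h⟩

lemma volume_union_of_le_of_ge (i : Fin 2) (c : ℝ) {A B : Set (EuclideanSpace ℝ (Fin 2))}
    (hB : MeasurableSet B) (hA' : ∀ x ∈ A, x i ≤ c) (hB' : ∀ x ∈ B, c ≤ x i) :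
    volume (A ∪ B) = volume A + volume B := by
  apply measure_union₀ hB.nullMeasurableSet
  apply measure_mono_null (t := {x : EuclideanSpace ℝ (Fin 2) | x i = c})
    fun x hx => le_antisymm (hA' x hx.1) (hB' x hx.2)
  have hm : MeasurableSet {f : Fin 2 → ℝ | f i = c} :=
    measurableSet_eq_fun (by fun_prop) (by fun_prop)
  have := (PiLp.volume_preserving_ofLp (Fin 2)).measure_preimage hm.nullMeasurableSet
  rw [volume_pi, Measure.pi_hyperplane] at this
  exact this

end CantorMap

namespace IsCantorDust

variable {r : ℝ} {C : Set (EuclideanSpace ℝ (Fin 2))}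

lemma mem_iff (hC : IsCantorDust r C) (x : EuclideanSpace ℝ (Fin 2)) :
    x ∈ C ↔ ∃ c ∈ C, (x 0 = r⁻¹ * c 0 ∨ x 0 = r⁻¹ * c 0 + (r - 1) / r) ∧
      (x 1 = r⁻¹ * c 1 ∨ x 1 = r⁻¹ * c 1 + (r - 1) / r) := by
  have key (a b : ℝ) (c : EuclideanSpace ℝ (Fin 2)) :
      cantorMap r a b c = x ↔ x 0 = r⁻¹ * c 0 + a ∧ x 1 = r⁻¹ * c 1 + b := by
    constructor
    · rintro rfl
      exact ⟨cantorMap_apply_zero .., cantorMap_apply_one ..⟩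
    · rintro ⟨h0, h1⟩
      ext i
      fin_cases i
      · exact (cantorMap_apply_zero ..).trans h0.symm
      · exact (cantorMap_apply_one ..).trans h1.symm
  conv_lhs => rw [hC.2.2]
  simp only [mem_union, mem_image, key, add_zero]
  constructor
  · rintro (((⟨c, hc, h⟩ | ⟨c, hc, h⟩) | ⟨c, hc, h⟩) | ⟨c, hc, h⟩) <;>
      exact ⟨c, hc, by tauto⟩
  · rintro ⟨c, hc, h0 | h0, h1 | h1⟩
    · exact Or.inl (Or.inl (Or.inl ⟨c, hc, h0, h1⟩))
    · exact Or.inr ⟨c, hc, h0, h1⟩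
    · exact Or.inl (Or.inl (Or.inr ⟨c, hc, h0, h1⟩))
    · exact Or.inl (Or.inr ⟨c, hc, h0, h1⟩)

lemma isCantorLine_image (hC : IsCantorDust r C) (i : Fin 2) :
    IsCantorLine r ((fun x => x i) '' C) := by
  refine ⟨hC.1.image (by fun_prop), hC.2.1.image _, fun t => ⟨?_, ?_⟩⟩
  · rintro ⟨x, hx, rfl⟩
    obtain ⟨c, hc, h0, h1⟩ := (hC.mem_iff x).1 hx
    refine ⟨c i, mem_image_of_mem _ hc, ?_⟩
    fin_cases i
    · exact h0
    · exact h1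
  · rintro ⟨_, ⟨c, hc, rfl⟩, h⟩
    refine ⟨!₂[t + (r⁻¹ * c 0 - r⁻¹ * c i), t + (r⁻¹ * c 1 - r⁻¹ * c i)],
      (hC.mem_iff _).2 ⟨c, hc, ?_⟩, ?_⟩
    · rcases h with rfl | rfl
      · exact ⟨Or.inl (by simp), Or.inl (by simp)⟩
      · exact ⟨Or.inr (by simp; ring), Or.inr (by simp; ring)⟩
    · fin_cases i <;> simp

lemma infDist_le_inv_mul (hC : IsCantorDust r C) (hr : 2 < r) {x z : EuclideanSpace ℝ (Fin 2)}
    (h0 : x 0 = r⁻¹ * z 0 ∨ x 0 = r⁻¹ * z 0 + (r - 1) / r)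
    (h1 : x 1 = r⁻¹ * z 1 ∨ x 1 = r⁻¹ * z 1 + (r - 1) / r) :
    infDist x C ≤ r⁻¹ * infDist z C := by
  obtain ⟨c, hc, h⟩ := hC.1.exists_infDist_eq_dist hC.2.1 z
  obtain ⟨v, hv⟩ : ∃ v : EuclideanSpace ℝ (Fin 2), v = !₂[x 0 - r⁻¹ * z 0, x 1 - r⁻¹ * z 1] :=
    ⟨_, rfl⟩
  have hx : x = r⁻¹ • z + v := by
    ext i
    fin_cases i <;> simp [hv]
  have hmem : r⁻¹ • c + v ∈ C := by
    refine (hC.mem_iff _).2 ⟨c, hc, ?_, ?_⟩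
    · rcases h0 with h0 | h0 <;> simp [hv, h0]
    · rcases h1 with h1 | h1 <;> simp [hv, h1]
  refine (infDist_le_dist_of_mem hmem).trans_eq ?_
  rw [hx, dist_add_right, dist_smul₀, Real.norm_eq_abs, abs_of_pos (by positivity), h]

/-- A Cantor dust is the product of its two coordinate projections. -/
lemma mem_iff_mem_image (hC : IsCantorDust r C) (hr : 2 < r) (x : EuclideanSpace ℝ (Fin 2)) :
    x ∈ C ↔ x 0 ∈ (fun x => x 0) '' C ∧ x 1 ∈ (fun x => x 1) '' C := by
  refine ⟨fun hx => ⟨mem_image_of_mem _ hx, mem_image_of_mem _ hx⟩, fun hx => ?_⟩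
  have h₀ := hC.isCantorLine_image 0
  have h₁ := hC.isCantorLine_image 1
  set K₀ := (fun x : EuclideanSpace ℝ (Fin 2) => x 0) '' C
  set K₁ := (fun x : EuclideanSpace ℝ (Fin 2) => x 1) '' C
  have hcont : Continuous fun p : ℝ × ℝ => infDist (!₂[p.1, p.2] : EuclideanSpace ℝ (Fin 2)) C :=
    (continuous_infDist_pt C).comp (by fun_prop)
  obtain ⟨⟨a, b⟩, ⟨ha, hb⟩, hmax⟩ := (h₀.1.prod h₁.1).exists_isMaxOn (h₀.2.1.prod h₁.2.1)
    hcont.continuousOn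
  have hmax' : ∀ s ∈ K₀, ∀ t ∈ K₁, infDist (!₂[s, t] : EuclideanSpace ℝ (Fin 2)) C ≤
      infDist (!₂[a, b] : EuclideanSpace ℝ (Fin 2)) C :=
    fun s hs t ht => isMaxOn_iff.1 hmax (s, t) ⟨hs, ht⟩
  obtain ⟨a', ha', ha⟩ := (h₀.2.2 a).1 ha
  obtain ⟨b', hb', hb⟩ := (h₁.2.2 b).1 hb
  have hle : infDist (!₂[a, b] : EuclideanSpace ℝ (Fin 2)) C ≤
      r⁻¹ * infDist (!₂[a', b'] : EuclideanSpace ℝ (Fin 2)) C :=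
    hC.infDist_le_inv_mul hr (by simpa using ha) (by simpa using hb)
  have hle' := hmax' a' ha' b' hb'
  have hx' := hmax' (x 0) hx.1 (x 1) hx.2
  rw [show !₂[x 0, x 1] = x by ext i; fin_cases i <;> rfl] at hx'
  have hr0 : 0 < r⁻¹ := by positivity
  have hr1 : r⁻¹ < 1 := inv_lt_one_of_one_lt₀ (by linarith)
  rw [hC.1.isClosed.mem_iff_infDist_zero hC.2.1]
  have := infDist_nonneg (x := x) (s := C)
  nlinarith

lemma mem_cthickening_iff (hC : IsCantorDust r C) (hr : 2 < r) {ε : ℝ} (hε : 0 ≤ ε)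
    (x : EuclideanSpace ℝ (Fin 2)) :
    x ∈ cthickening ε C ↔ infDist (x 0) ((fun x => x 0) '' C) ^ 2 +
      infDist (x 1) ((fun x => x 1) '' C) ^ 2 ≤ ε ^ 2 := by
  have hdist (x y : EuclideanSpace ℝ (Fin 2)) : dist x y ≤ ε ↔
      dist (x 0) (y 0) ^ 2 + dist (x 1) (y 1) ^ 2 ≤ ε ^ 2 := by
    rw [EuclideanSpace.dist_eq, Fin.sum_univ_two, Real.sqrt_le_left hε]
  have h₀ := hC.isCantorLine_image 0
  have h₁ := hC.isCantorLine_image 1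
  rw [mem_cthickening_iff_of_isCompact hC.1 hε]
  simp only [hdist]
  constructor
  · rintro ⟨c, hc, h⟩
    refine le_trans ?_ h
    gcongr
    · exact infDist_nonneg
    · exact infDist_le_dist_of_mem (mem_image_of_mem _ hc)
    · exact infDist_nonneg
    · exact infDist_le_dist_of_mem (mem_image_of_mem _ hc)
  · intro h
    obtain ⟨a, ha, ha'⟩ := h₀.1.exists_infDist_eq_dist h₀.2.1 (x 0)
    obtain ⟨b, hb, hb'⟩ := h₁.1.exists_infDist_eq_dist h₁.2.1 (x 1)
    refine ⟨!₂[a, b], (hC.mem_iff_mem_image hr _).2 ⟨by simpa using ha, by simpa using hb⟩, ?_⟩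
    rw [ha', hb'] at h
    simpa using h

lemma volume_cthickening (hC : IsCantorDust r C) (hr : 2 < r) {ε : ℝ} (hε : 0 ≤ ε)
    (hε' : (1 - 2 * r⁻¹) ^ 2 / 2 ≤ ε ^ 2) :
    (volume (cthickening ε C)).toReal = π * ε ^ 2 +
      2 * (∫ t in (0 : ℝ)..1, √(ε ^ 2 - infDist t ((fun x => x 0) '' C) ^ 2)) +
      2 * (∫ t in (0 : ℝ)..1, √(ε ^ 2 - infDist t ((fun x => x 1) '' C) ^ 2)) + 1 := by
  set S := {p : ℝ × ℝ | infDist p.1 ((fun x => x 0) '' C) ^ 2 +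
    infDist p.2 ((fun x => x 1) '' C) ^ 2 ≤ ε ^ 2} with hS
  have hm : MeasurableSet S := measurableSet_le (by fun_prop) (by fun_prop)
  have hvol : volume (cthickening ε C) = volume S := by
    rw [← ((volume_preserving_finTwoArrow ℝ).comp
      (PiLp.volume_preserving_ofLp (Fin 2))).measure_preimage hm.nullMeasurableSet]
    congr 1
    ext x
    exact hC.mem_cthickening_iff hr hε x
  rw [hvol, IsCantorLine.volume_setOf_infDist_sq_add_le (hC.isCantorLine_image 0)
    (hC.isCantorLine_image 1) hr hε hε', ENNReal.toReal_ofReal]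
  have hI (K : Set ℝ) : 0 ≤ ∫ t in (0 : ℝ)..1, √(ε ^ 2 - infDist t K ^ 2) :=
    intervalIntegral.integral_nonneg zero_le_one fun _ _ => Real.sqrt_nonneg _
  have := hI ((fun x : EuclideanSpace ℝ (Fin 2) => x 0) '' C)
  have := hI ((fun x : EuclideanSpace ℝ (Fin 2) => x 1) '' C)
  positivity

lemma volume_cthickening_of_le (hC : IsCantorDust r C) (hr : 2 < r) {ε : ℝ} (hε : 0 ≤ ε)
    (hε' : ε ≤ (1 - 2 * r⁻¹) / 2) :
    (volume (cthickening ε C)).toReal =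
      4 * r⁻¹ ^ 2 * (volume (cthickening (r * ε) C)).toReal := by
  have hr0 : 0 < r := by linarith
  have hr' : (r - 1) / r = 1 - r⁻¹ := by field_simp
  have hCi (i : Fin 2) {x : EuclideanSpace ℝ (Fin 2)} (hx : x ∈ C) : x i ∈ Icc (0 : ℝ) 1 :=
    (hC.isCantorLine_image i).subset_Icc hr (mem_image_of_mem _ hx)
  have habs {A : Set (EuclideanSpace ℝ (Fin 2))} (hA : IsCompact A)
      {x : EuclideanSpace ℝ (Fin 2)} (hx : x ∈ cthickening ε A) (i : Fin 2) :
      ∃ c ∈ A, |x i - c i| ≤ ε := by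
    obtain ⟨c, hc, h⟩ := (mem_cthickening_iff_of_isCompact hA hε).1 hx
    refine ⟨c, hc, le_trans ?_ h⟩
    rw [dist_eq_norm]
    exact PiLp.norm_apply_le (x - c) i
  have hcpt (a b : ℝ) : IsCompact (cantorMap r a b '' C) := hC.1.image continuous_cantorMap
  have hlow (i : Fin 2) {a b : ℝ} (hi : ∀ x, cantorMap r a b x i = r⁻¹ * x i) :
      ∀ x ∈ cthickening ε (cantorMap r a b '' C), x i ≤ 1 / 2 := by
    intro x hx
    obtain ⟨_, ⟨c, hc, rfl⟩, h⟩ := habs (hcpt a b) hx i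
    rw [hi] at h
    nlinarith [(hCi i hc).2, (abs_le.1 h).2, inv_pos.2 hr0]
  have hhigh (i : Fin 2) {a b : ℝ}
      (hi : ∀ x, cantorMap r a b x i = r⁻¹ * x i + (r - 1) / r) :
      ∀ x ∈ cthickening ε (cantorMap r a b '' C), 1 / 2 ≤ x i := by
    intro x hx
    obtain ⟨_, ⟨c, hc, rfl⟩, h⟩ := habs (hcpt a b) hx i
    rw [hi, hr'] at h
    nlinarith [(hCi i hc).1, (abs_le.1 h).1, inv_pos.2 hr0]
  have hvol (a b : ℝ) : volume (cthickening ε (cantorMap r a b '' C)) =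
      ENNReal.ofReal (r⁻¹ ^ 2) * volume (cthickening (r * ε) C) := by
    rw [cthickening_image_cantorMap hr0 hC.1 hε, volume_image_cantorMap]
  have hsplit : cthickening ε C =
      (cthickening ε (cantorMap r 0 0 '' C) ∪
        cthickening ε (cantorMap r 0 ((r - 1) / r) '' C)) ∪
      (cthickening ε (cantorMap r ((r - 1) / r) 0 '' C) ∪
        cthickening ε (cantorMap r ((r - 1) / r) ((r - 1) / r) '' C)) := by
    conv_lhs => rw [hC.2.2]
    rw [cthickening_union, cthickening_union, cthickening_union]
    ext x
    simp only [mem_union]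
    tauto
  have hm (a b : ℝ) : MeasurableSet (cthickening ε (cantorMap r a b '' C)) :=
    isClosed_cthickening.measurableSet
  have h : volume (cthickening ε C) =
      4 * (ENNReal.ofReal (r⁻¹ ^ 2) * volume (cthickening (r * ε) C)) := by
    rw [hsplit, volume_union_of_le_of_ge 0 (1 / 2) ((hm _ _).union (hm _ _)),
      volume_union_of_le_of_ge 1 (1 / 2) (hm _ _), volume_union_of_le_of_ge 1 (1 / 2) (hm _ _)]
    · simp only [hvol]
      ring
    · exact hlow 1 fun x => by rw [cantorMap_apply_one, add_zero]
    · exact hhigh 1 fun x => cantorMap_apply_one ..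
    · exact hlow 1 fun x => by rw [cantorMap_apply_one, add_zero]
    · exact hhigh 1 fun x => cantorMap_apply_one ..
    · rintro x (hx | hx)
      · exact hlow 0 (fun x => by rw [cantorMap_apply_zero, add_zero]) x hx
      · exact hlow 0 (fun x => by rw [cantorMap_apply_zero, add_zero]) x hx
    · rintro x (hx | hx)
      · exact hhigh 0 (fun x => cantorMap_apply_zero ..) x hx
      · exact hhigh 0 (fun x => cantorMap_apply_zero ..) x hx
  rw [h, ENNReal.toReal_mul, ENNReal.toReal_mul, ENNReal.toReal_ofReal (by positivity)]
  norm_num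
  ring

end IsCantorDust

lemma rpow_log_div_log {r x : ℝ} (hr : 1 < r) (hx : 0 < x) :
    r ^ (Real.log x / Real.log r) = x := by
  rw [Real.rpow_def_of_pos (by linarith), mul_div_cancel₀ _ (Real.log_pos hr).ne',
    Real.exp_log hx]

lemma f₁_eq {r : ℝ} (hr : 2 < r) :
    f₁ r = (1 + 2 * (r - 2) + π * ((r - 2) / 2) ^ 2 -
      (r - √(r ^ 2 - 1)) * ((r - 2) / r) * (r - 1) / r) /
        ((r - 2) / 2) ^ (2 - Real.log 4 / Real.log r) := by
  have h2 : 0 < r - 2 := by linarith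
  rw [f₁, sub_eq_add_neg 2, Real.rpow_add (by positivity), div_eq_mul_one_div (r - 2) 2,
    Real.mul_rpow h2.le (by norm_num), Real.mul_rpow h2.le (by norm_num), Real.rpow_two,
    Real.rpow_two]
  congr 1
  · field_simp
    ring
  · ring

lemma f₂_eq {r : ℝ} (hr : 2 < r) :
    f₂ r = (1 + 4 * (√(1 / 2) * ((r - 2) / r)) + π * (√(1 / 2) * ((r - 2) / r)) ^ 2) /
        (√(1 / 2) * ((r - 2) / r)) ^ (2 - Real.log 4 / Real.log r) := by
  have hg : 0 < (r - 2) / r := div_pos (by linarith) (by linarith)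
  have h8 : √8 = 4 * √(1 / 2) := by
    rw [show (8 : ℝ) = 4 ^ 2 * (1 / 2) by norm_num, Real.sqrt_mul (by norm_num),
      Real.sqrt_sq (by norm_num)]
  have hs : √(1 / 2 : ℝ) ^ 2 = 1 / 2 := Real.sq_sqrt (by norm_num)
  rw [f₂, sub_eq_add_neg 2, Real.rpow_add (by positivity),
    Real.mul_rpow (Real.sqrt_nonneg _) hg.le, Real.mul_rpow (Real.sqrt_nonneg _) hg.le,
    Real.rpow_two, Real.rpow_two, mul_pow, hs, h8]
  congr 1
  · ring
  · ring

namespace IsCantorDust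

variable {r : ℝ} {C : Set (EuclideanSpace ℝ (Fin 2))}

lemma volume_div_rpow_inv_mul (hC : IsCantorDust r C) (hr : 2 < r) {ε : ℝ} (hε : 0 < ε)
    (hε' : ε ≤ (r - 2) / 2) :
    (volume (cthickening (r⁻¹ * ε) C)).toReal /
        (r⁻¹ * ε) ^ (2 - Real.log 4 / Real.log r) =
      (volume (cthickening ε C)).toReal / ε ^ (2 - Real.log 4 / Real.log r) := by
  have hr0 : 0 < r := by linarith
  have hpow : r⁻¹ ^ (2 - Real.log 4 / Real.log r) = 4 * r⁻¹ ^ 2 := by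
    rw [Real.rpow_sub (by positivity), Real.inv_rpow hr0.le (Real.log 4 / Real.log r),
      rpow_log_div_log (by linarith) (by norm_num), Real.rpow_two, div_inv_eq_mul, mul_comm]
  rw [hC.volume_cthickening_of_le hr (by positivity), mul_inv_cancel_left₀ hr0.ne',
    Real.mul_rpow (by positivity) hε.le, hpow, mul_div_mul_left _ _ (by positivity)]
  rw [inv_mul_le_iff₀ hr0]
  refine hε'.trans_eq ?_
  field_simp

lemma volume_div_rpow_mul_pow (hC : IsCantorDust r C) (hr : 2 < r) {ε : ℝ} (hε : 0 < ε)
    (hε' : ε ≤ (r - 2) / 2) (n : ℕ) :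
    (volume (cthickening (ε * r⁻¹ ^ n) C)).toReal /
        (ε * r⁻¹ ^ n) ^ (2 - Real.log 4 / Real.log r) =
      (volume (cthickening ε C)).toReal / ε ^ (2 - Real.log 4 / Real.log r) := by
  have hr0 : 0 < r⁻¹ := by positivity
  induction n with
  | zero => simp
  | succ n ih =>
    rw [← ih, pow_succ', mul_left_comm, hC.volume_div_rpow_inv_mul hr (by positivity)]
    refine le_trans (mul_le_of_le_one_right hε.le (pow_le_one₀ hr0.le ?_)) hε'
    exact inv_le_one_of_one_le₀ (by linarith)

lemma f₁_lt (hC : IsCantorDust r C) (hr : 2 < r) :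
    f₁ r < (volume (cthickening ((r - 2) / 2) C)).toReal /
      ((r - 2) / 2) ^ (2 - Real.log 4 / Real.log r) := by
  have h2 : 0 < (r - 2) / 2 := by linarith
  rw [f₁_eq hr, hC.volume_cthickening hr h2.le]
  · have h₀ := (hC.isCantorLine_image 0).lt_integral_sqrt hr
    have h₁ := (hC.isCantorLine_image 1).lt_integral_sqrt hr
    rw [mul_comm 4 r, ← div_div] at h₀ h₁
    gcongr
    linarith
  · have hg : 1 - 2 * r⁻¹ = (r - 2) * r⁻¹ := by field_simp
    have hr1 : r⁻¹ ^ 2 ≤ (1 / 2) ^ 2 := by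
      gcongr
      rw [inv_le_comm₀] <;> norm_num <;> linarith
    rw [hg, mul_pow]
    nlinarith [sq_nonneg (r - 2)]

lemma lt_f₂ (hC : IsCantorDust r C) (hr : 2 < r) :
    (volume (cthickening (√(1 / 2) * ((r - 2) / r)) C)).toReal /
      (√(1 / 2) * ((r - 2) / r)) ^ (2 - Real.log 4 / Real.log r) < f₂ r := by
  have hg : 0 < (r - 2) / r := div_pos (by linarith) (by linarith)
  have hε : 0 < √(1 / 2) * ((r - 2) / r) := by positivity
  rw [f₂_eq hr, hC.volume_cthickening hr hε.le]
  · have h₀ := (hC.isCantorLine_image 0).integral_sqrt_lt hr hε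
    have h₁ := (hC.isCantorLine_image 1).integral_sqrt_lt hr hε
    refine div_lt_div_of_pos_right ?_ (by positivity)
    linarith
  · rw [mul_pow, Real.sq_sqrt (by norm_num), show (r - 2) / r = 1 - 2 * r⁻¹ by field_simp]
    linarith

/-- The normalized parallel volume of a Cantor dust is bounded for small radii. -/
lemma isBoundedUnder_volume_div_rpow (hC : IsCantorDust r C) (hr : 2 < r) :
    IsBoundedUnder (· ≤ ·) (𝓝[>] 0) fun ε : ℝ =>
      (volume (cthickening ε C)).toReal / ε ^ (2 - Real.log 4 / Real.log r) := by
  have hr0 : 0 < r := by linarith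
  set δ := (r - 2) / 2 with hδ
  have hδ0 : 0 < δ := by linarith
  have hD : 0 < 2 - Real.log 4 / Real.log r := by
    have hlog : 0 < Real.log r := Real.log_pos (by linarith)
    rw [sub_pos, div_lt_iff₀ hlog, show (2 : ℝ) = (2 : ℕ) by norm_num, ← Real.log_pow]
    exact Real.log_lt_log (by norm_num) (by nlinarith)
  refine ⟨(volume (cthickening δ C)).toReal / (r⁻¹ * δ) ^ (2 - Real.log 4 / Real.log r), ?_⟩
  rw [Filter.eventually_map]
  filter_upwards [Ioc_mem_nhdsGT hδ0] with ε hε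
  obtain ⟨n, hn, hn'⟩ := exists_nat_pow_near_of_lt_one (x := ε / δ) (y := r⁻¹)
    (div_pos hε.1 hδ0) ((div_le_one₀ hδ0).2 hε.2) (by positivity)
    (inv_lt_one_of_one_lt₀ (by linarith))
  have hpn : (0 : ℝ) < r⁻¹ ^ n := by positivity
  have hη : ε = ε / r⁻¹ ^ n * r⁻¹ ^ n := by field_simp
  have hle : ε / r⁻¹ ^ n ≤ δ := by
    rw [div_le_iff₀ hδ0] at hn'
    rw [div_le_iff₀ hpn]
    linarith
  have hge : r⁻¹ * δ ≤ ε / r⁻¹ ^ n := by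
    rw [lt_div_iff₀ hδ0, pow_succ] at hn
    rw [le_div_iff₀ hpn]
    linarith
  rw [hη, hC.volume_div_rpow_mul_pow hr (div_pos hε.1 hpn) hle]
  gcongr
  · exact hC.1.cthickening.measure_ne_top
  · exact cthickening_mono hle C

end IsCantorDust

lemma tendsto_mul_inv_pow_nhdsGT {r ε : ℝ} (hr : 1 < r) (hε : 0 < ε) :
    Tendsto (fun n : ℕ => ε * r⁻¹ ^ n) atTop (𝓝[>] 0) := by
  rw [tendsto_nhdsWithin_iff]
  have hr0 : 0 < r⁻¹ := by positivity
  refine ⟨?_, Filter.Eventually.of_forall fun n => mem_Ioi.2 (by positivity)⟩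
  simpa using (tendsto_pow_atTop_nhds_zero_of_lt_one hr0.le
    (inv_lt_one_of_one_lt₀ hr)).const_mul ε

/-- Suppose `r > 2` and `f₁(r) ≥ f₂(r)`. Then `C^r` is not Minkowski measurable: along the
sequence `ε = (1/2)·((r-2)/r)·r^(-(n-1))` (for `n ≥ 1`) the normalized parallel volume exceeds
`f₁(r)`, along `ε = √(1/2)·((r-2)/r)·r^(-n)` it is below `f₂(r)`; consequently the limsup of
`ε ↦ λ²((C^r)_ε)/ε^(2-D_r)` as `ε → 0⁺` is at least `f₁(r)`, its liminf is at most `f₂(r)`,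
and the function has no limit in `(0, ∞)` as `ε → 0⁺`. -/
theorem stmt_11 (r : ℝ) (hr : 2 < r) (C : Set (EuclideanSpace ℝ (Fin 2)))
    (hC : IsCantorDust r C) (hf : f₂ r ≤ f₁ r) :
    (∀ n : ℕ, 1 ≤ n →
      f₁ r <
        (volume (cthickening (1 / 2 * ((r - 2) / r) * r ^ (-((n : ℝ) - 1))) C)).toReal /
          (1 / 2 * ((r - 2) / r) * r ^ (-((n : ℝ) - 1))) ^ (2 - Real.log 4 / Real.log r)) ∧
    (∀ n : ℕ,
      (volume (cthickening (Real.sqrt (1 / 2) * ((r - 2) / r) * r ^ (-(n : ℝ))) C)).toReal /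
          (Real.sqrt (1 / 2) * ((r - 2) / r) * r ^ (-(n : ℝ))) ^ (2 - Real.log 4 / Real.log r) <
        f₂ r) ∧
    f₁ r ≤
      Filter.limsup
        (fun ε : ℝ => (volume (cthickening ε C)).toReal / ε ^ (2 - Real.log 4 / Real.log r))
        (𝓝[>] 0) ∧
    Filter.liminf
        (fun ε : ℝ => (volume (cthickening ε C)).toReal / ε ^ (2 - Real.log 4 / Real.log r))
        (𝓝[>] 0) ≤ f₂ r ∧
    ¬ ∃ L : ℝ, 0 < L ∧
        Filter.Tendsto
          (fun ε : ℝ => (volume (cthickening ε C)).toReal / ε ^ (2 - Real.log 4 / Real.log r))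
          (𝓝[>] 0) (𝓝 L) := by
  have hr0 : 0 < r := by linarith
  have hg : 0 < (r - 2) / r := div_pos (by linarith) hr0
  have hδ : 0 < (r - 2) / 2 := by linarith
  have hη : 0 < √(1 / 2) * ((r - 2) / r) := by positivity
  have hηδ : √(1 / 2) * ((r - 2) / r) ≤ (r - 2) / 2 := by
    have hs : √(1 / 2 : ℝ) ≤ 1 := Real.sqrt_le_one.2 (by norm_num)
    have : (r - 2) / r ≤ (r - 2) / 2 := by gcongr
    nlinarith
  have hpow (n : ℕ) : r ^ (-(n : ℝ)) = r⁻¹ ^ n := by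
    rw [Real.rpow_neg hr0.le, Real.rpow_natCast, inv_pow]
  set E : ℝ → ℝ :=
    fun ε => (volume (cthickening ε C)).toReal / ε ^ (2 - Real.log 4 / Real.log r) with hE
  have hE₁ (n : ℕ) : f₁ r < E ((r - 2) / 2 * r⁻¹ ^ n) :=
    (hC.f₁_lt hr).trans_eq (hC.volume_div_rpow_mul_pow hr hδ le_rfl n).symm
  have hE₂ (n : ℕ) : E (√(1 / 2) * ((r - 2) / r) * r⁻¹ ^ n) < f₂ r :=
    (hC.volume_div_rpow_mul_pow hr hη hηδ n).trans_lt (hC.lt_f₂ hr)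
  have ht₁ := tendsto_mul_inv_pow_nhdsGT (by linarith : 1 < r) hδ
  have ht₂ := tendsto_mul_inv_pow_nhdsGT (by linarith : 1 < r) hη
  refine ⟨fun n _ => ?_, fun n => ?_, ?_, ?_, ?_⟩
  · have h : 1 / 2 * ((r - 2) / r) * r ^ (-((n : ℝ) - 1)) = (r - 2) / 2 * r⁻¹ ^ n := by
      rw [neg_sub, sub_eq_add_neg 1, Real.rpow_add hr0, Real.rpow_one, hpow]
      field_simp
    rw [h]
    exact hE₁ n
  · rw [hpow]
    exact hE₂ n
  · exact Filter.le_limsup_of_frequently_le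
      (ht₁.frequently (Filter.Frequently.of_forall fun n => (hE₁ n).le))
      (hC.isBoundedUnder_volume_div_rpow hr)
  · refine Filter.liminf_le_of_frequently_le
      (ht₂.frequently (Filter.Frequently.of_forall fun n => (hE₂ n).le)) ⟨0, ?_⟩
    rw [Filter.eventually_map]
    filter_upwards [self_mem_nhdsWithin] with ε hε
    exact div_nonneg ENNReal.toReal_nonneg (Real.rpow_nonneg (le_of_lt hε) _)
  · rintro ⟨L, _, hL⟩
    have hL₁ : E ((r - 2) / 2) = L := by
      refine tendsto_nhds_unique ?_ (hL.comp ht₁)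
      exact tendsto_const_nhds.congr fun n =>
        (hC.volume_div_rpow_mul_pow hr hδ le_rfl n).symm
    have hL₂ : E (√(1 / 2) * ((r - 2) / r)) = L := by
      refine tendsto_nhds_unique ?_ (hL.comp ht₂)
      exact tendsto_const_nhds.congr fun n =>
        (hC.volume_div_rpow_mul_pow hr hη hηδ n).symm
    have h₁ := hC.f₁_lt hr
    have h₂ := hC.lt_f₂ hr
    simp only [hE] at hL₁ hL₂
    rw [hL₁] at h₁
    rw [hL₂] at h₂
    linarith
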